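/- For every fixed t ≥ 0, the function x ↦ ψ(t, x) is differentiable on ℝ with ∂ψ/∂x (t, x) = φ'(x)·(1 − (1 + t/φ(x))·exp(−t/φ(x))), and |∂ψ/∂x (t, x)| ≤ √2/2 for all t ≥ 0 and x ∈ ℝ. -/

import Mathlib

/-- The basic weight function `φ(x) = ln(x² + 2)`, with derivative `φ'(x) = 2x/(x² + 2)`. -/
noncomputable def φ (x : ℝ) : ℝ := Real.log (x ^ 2 + 2)

/-- The space-time weight `ψ(t,x) = φ(x)·(1 − exp(−t/φ(x)))`. -/
noncomputable def ψ (t x : ℝ) : ℝ := φ x * (1 - Real.exp (-t / φ x))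

theorem φ_pos (x : ℝ) : 0 < φ x :=
  Real.log_pos (by nlinarith [sq_nonneg x])

theorem hasDerivAt_φ (x : ℝ) : HasDerivAt φ (2 * x / (x ^ 2 + 2)) x := by
  have h : HasDerivAt (fun y : ℝ => y ^ 2 + 2) (2 * x) x := by
    simpa using (hasDerivAt_pow 2 x).add_const (2 : ℝ)
  exact h.log (by positivity)

theorem abs_two_mul_div_sq_add_two_le (x : ℝ) : |2 * x / (x ^ 2 + 2)| ≤ Real.sqrt 2 / 2 := by
  have hs : Real.sqrt 2 ^ 2 = 2 := Real.sq_sqrt (by norm_num)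
  have hpos : 0 < Real.sqrt 2 := by positivity
  have hx : 0 < x ^ 2 + 2 := by positivity
  rw [abs_div, abs_of_pos hx, div_le_div_iff₀ hx two_pos, abs_mul, abs_two]
  nlinarith [mul_nonneg hpos.le (sq_nonneg (|x| - Real.sqrt 2)), sq_abs x]

theorem abs_one_sub_one_add_mul_exp_neg_le_one {s : ℝ} (hs : 0 ≤ s) :
    |1 - (1 + s) * Real.exp (-s)| ≤ 1 := by
  have hle : (1 + s) * Real.exp (-s) ≤ 1 := by
    rw [Real.exp_neg, ← div_eq_mul_inv, div_le_one (Real.exp_pos s), add_comm]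
    exact Real.add_one_le_exp s
  have hnonneg : 0 ≤ (1 + s) * Real.exp (-s) := by positivity
  rw [abs_le]
  constructor <;> linarith

/-- For every fixed `t ≥ 0`, the function `x ↦ ψ(t, x)` is differentiable on `ℝ`
with `∂ψ/∂x (t, x) = φ'(x)·(1 − (1 + t/φ(x))·exp(−t/φ(x)))` (where `φ'(x) = 2x/(x²+2)`),
and `|∂ψ/∂x (t, x)| ≤ √2/2` for all `t ≥ 0` and `x ∈ ℝ`. -/
theorem stmt_3 (t : ℝ) (ht : 0 ≤ t) (x : ℝ) :
    HasDerivAt (fun y : ℝ => ψ t y)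
      (2 * x / (x ^ 2 + 2) * (1 - (1 + t / φ x) * Real.exp (-t / φ x))) x ∧
    |2 * x / (x ^ 2 + 2) * (1 - (1 + t / φ x) * Real.exp (-t / φ x))| ≤ Real.sqrt 2 / 2 := by
  have hφ : φ x ≠ 0 := (φ_pos x).ne'
  constructor
  · have hquot := (hasDerivAt_const x (-t)).div (hasDerivAt_φ x) hφ
    refine ((hasDerivAt_φ x).mul (hquot.exp.const_sub 1)).congr_deriv ?_
    simp only [Pi.div_apply]
    field_simp
    ring
  · rw [abs_mul, neg_div]
    calc _ ≤ Real.sqrt 2 / 2 * 1 :=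
          mul_le_mul (abs_two_mul_div_sq_add_two_le x)
            (abs_one_sub_one_add_mul_exp_neg_le_one (div_nonneg ht (φ_pos x).le))
            (abs_nonneg _) (by positivity)
      _ = Real.sqrt 2 / 2 := mul_one _
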